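/- Let θ be an irrational real number with 0 < θ < 1 whose continued fraction partial quotients are bounded by B, and let s = (s_i)_{i ≥ 0} be the characteristic Sturmian sequence s_i = ⌊(i+2)θ⌋ − ⌊(i+1)θ⌋. Then for all integers r, a, b with 0 ≤ a < b < r, there exists an index i with 0 ≤ i ≤ 2(B+2)²r² such that s_{ri+a} ≠ s_{ri+b}. In other words, the function r ↦ 2(B+2)²r² is a diversity measure for s. -/

import Mathlib

/-- `θ` has all partial quotients `a_i` (for `i ≥ 1`) of its simple continued fraction
expansion bounded by `B`.  (Index `i` of `partDens` corresponds to `a_{i+1}`.) -/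
def PartQuotBounded (θ : ℝ) (B : ℕ) : Prop :=
  ∀ i : ℕ, ∀ a ∈ ((GenContFract.of θ).partDens.get? i), a ≤ (B : ℝ)

/-- The characteristic Sturmian sequence of slope `θ`: `s_i = ⌊(i+2)θ⌋ - ⌊(i+1)θ⌋`. -/
noncomputable def sturmian (θ : ℝ) (i : ℕ) : ℤ :=
  ⌊((i : ℝ) + 2) * θ⌋ - ⌊((i : ℝ) + 1) * θ⌋

open GenContFract in
theorem exists_int_contsAux_eq (v : ℝ) (n : ℕ) :
    ∃ p q : ℤ, (GenContFract.of v).contsAux n = ⟨p, q⟩ := by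
  induction n using Nat.twoStepInduction with
  | zero => exact ⟨1, 0, by simp⟩
  | one => exact ⟨⌊v⌋, 1, by simp [of_h_eq_floor]⟩
  | more n ih₀ ih₁ =>
    obtain ⟨p₀, q₀, h₀⟩ := ih₀
    obtain ⟨p₁, q₁, h₁⟩ := ih₁
    cases hs : (GenContFract.of v).s.get? n with
    | none => exact ⟨p₁, q₁, by rw [← h₁]; simp only [contsAux, hs]⟩
    | some gp =>
      obtain ⟨ha, z, hz⟩ := of_partNum_eq_one_and_exists_int_partDen_eq hs
      refine ⟨z * p₁ + p₀, z * q₁ + q₀, ?_⟩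
      rw [contsAux_recurrence hs h₀ h₁, ha, hz]
      push_cast
      simp

open GenContFract in
theorem not_terminatedAt_of_irrational {v : ℝ} (hv : Irrational v) (n : ℕ) :
    ¬ (GenContFract.of v).TerminatedAt n := fun h => by
  obtain ⟨q, hq⟩ := (terminates_iff_rat v).1 ⟨n, h⟩
  exact hv ⟨q, hq.symm⟩

open GenContFract in
/-- The convergents of an irrational number are in lowest terms. -/
theorem dens_eq_den_of_convs_eq {v : ℝ} (hv : Irrational v) {n : ℕ} {x : ℚ}
    (hx : (GenContFract.of v).convs n = x) :
    ((GenContFract.of v).contsAux (n + 1)).b = x.den := by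
  have det := (SimpContFract.of v).determinant (not_terminatedAt_of_irrational hv n)
  change ((GenContFract.of v).contsAux (n + 1)).a * ((GenContFract.of v).contsAux (n + 2)).b -
    ((GenContFract.of v).contsAux (n + 1)).b * ((GenContFract.of v).contsAux (n + 2)).a =
      (-1) ^ (n + 1) at det
  have hpos : 0 ≤ ((GenContFract.of v).contsAux (n + 1)).b := zero_le_of_contsAux_b
  have hconv : (GenContFract.of v).convs n =
    ((GenContFract.of v).contsAux (n + 1)).a / ((GenContFract.of v).contsAux (n + 1)).b := rfl
  obtain ⟨p, q, h⟩ := exists_int_contsAux_eq v (n + 1)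
  obtain ⟨p', q', h'⟩ := exists_int_contsAux_eq v (n + 2)
  rw [h, h'] at det
  rw [h] at hpos hconv ⊢
  simp only at det hpos hconv ⊢
  have detZ : p * q' - q * p' = (-1) ^ (n + 1) := by exact_mod_cast det
  have hq : 0 < q := by
    refine lt_of_le_of_ne (by exact_mod_cast hpos) fun h0 => ?_
    have hb : (Nat.fib (n + 1) : ℝ) ≤ ((GenContFract.of v).contsAux (n + 1)).b :=
      fib_le_of_contsAux_b (Or.inr (not_terminatedAt_of_irrational hv _))
    rw [h, ← h0] at hb
    have : 0 < Nat.fib (n + 1) := Nat.fib_pos.2 n.succ_pos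
    simp only [Int.cast_zero] at hb
    exact absurd hb (not_le.2 (by exact_mod_cast this))
  have hcop : IsCoprime p q := by
    refine ⟨(-1) ^ (n + 1) * q', -(-1) ^ (n + 1) * p', ?_⟩
    have : ((-1 : ℤ) ^ (n + 1)) * (-1) ^ (n + 1) = 1 := by
      rw [← mul_pow]; simp
    linear_combination (-1) ^ (n + 1) * detZ + this
  have hxq : x = p / q := by
    rw [hx] at hconv
    exact_mod_cast hconv
  have := Rat.den_div_eq_of_coprime hq (Int.isCoprime_iff_nat_coprime.1 hcop)
  rw [← hxq] at this
  exact_mod_cast this.symm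

open GenContFract in
/-- An irrational number with bounded partial quotients is badly approximable. -/
theorem PartQuotBounded.one_div_le_abs_sub_rat {θ : ℝ} (hθ : Irrational θ) {B : ℕ}
    (hB : PartQuotBounded θ B) (x : ℚ) :
    1 / ((B + 2) * (x.den : ℝ) ^ 2) ≤ |θ - x| := by
  by_contra! hlt
  have hden : (0 : ℝ) < x.den := by exact_mod_cast x.pos
  have hleg : |θ - x| < 1 / (2 * (x.den : ℝ) ^ 2) := by
    refine hlt.trans_le ?_
    gcongr
    linarith [(Nat.cast_nonneg B : (0 : ℝ) ≤ B)]
  obtain ⟨n, hn⟩ := Real.exists_convs_eq_rat hleg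
  have hb := dens_eq_den_of_convs_eq hθ hn
  obtain ⟨gp, hgp⟩ := Option.ne_none_iff_exists'.1 (not_terminatedAt_of_irrational hθ n)
  obtain ⟨ifp', hs', hgb⟩ := IntFractPair.exists_succ_get?_stream_of_gcf_of_get?_eq_some hgp
  obtain ⟨ifp, hs, hfr, hof⟩ := IntFractPair.succ_nth_stream_eq_some_iff.1 hs'
  have hsub := sub_convs_eq hs
  simp only [hfr, if_false, hn, hb] at hsub
  have hBgp : gp.b ≤ B := hB n gp.b (partDen_eq_s_b hgp)
  have hfl : ifp.fr⁻¹ < B + 1 := by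
    have h1 : (⌊ifp.fr⁻¹⌋ : ℝ) = gp.b := by rw [← hgb, ← hof]; rfl
    linarith [Int.lt_floor_add_one ifp.fr⁻¹]
  have hfr0 : 0 < ifp.fr :=
    lt_of_le_of_ne (IntFractPair.nth_stream_fr_nonneg hs) (Ne.symm hfr)
  have hpB0 : 0 ≤ ((GenContFract.of θ).contsAux n).b := zero_le_of_contsAux_b
  have hpB : ((GenContFract.of θ).contsAux n).b ≤ x.den := by
    rw [← hb]
    cases n with
    | zero => simp
    | succ m => exact of_den_mono
  rw [hsub, abs_div, abs_pow, abs_neg, abs_one, one_pow,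
    abs_of_pos (by positivity)] at hlt
  refine absurd hlt (not_lt.2 ?_)
  apply one_div_le_one_div_of_le (by positivity)
  calc (x.den : ℝ) * (ifp.fr⁻¹ * x.den + ((GenContFract.of θ).contsAux n).b)
      ≤ x.den * ((B + 1) * x.den + x.den) := by gcongr
    _ = (B + 2) * (x.den : ℝ) ^ 2 := by ring

/-- A badly approximable number in multiplicative form. -/
theorem PartQuotBounded.one_div_le_abs_mul_sub_int {θ : ℝ} (hθ : Irrational θ) {B : ℕ}
    (hB : PartQuotBounded θ B) {q : ℕ} (hq : 0 < q) (p : ℤ) :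
    1 / ((B + 2) * (q : ℝ)) ≤ |q * θ - p| := by
  have hq' : (0 : ℝ) < q := by exact_mod_cast hq
  have h := hB.one_div_le_abs_sub_rat hθ (p / q : ℚ)
  have hden : (((p / q : ℚ).den : ℕ) : ℝ) ≤ q := by
    have hd : (((p / (q : ℤ) : ℚ).den : ℕ) : ℤ) ∣ q := by
      rw [Rat.intCast_div_eq_divInt]
      exact Rat.den_dvd p q
    have := Int.le_of_dvd (by exact_mod_cast hq) hd
    exact_mod_cast this
  have hden0 : (0 : ℝ) < ((p / q : ℚ).den : ℕ) := by exact_mod_cast (p / q : ℚ).pos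
  have habs : |(q : ℝ) * θ - p| = q * |θ - ((p / q : ℚ) : ℝ)| := by
    rw [← abs_of_pos hq', ← abs_mul, abs_of_pos hq']
    congr 1
    push_cast
    field_simp
  calc 1 / ((B + 2) * (q : ℝ)) = q * (1 / ((B + 2) * (q : ℝ) ^ 2)) := by field_simp
    _ ≤ q * (1 / ((B + 2) * (((p / q : ℚ).den : ℕ) : ℝ) ^ 2)) := by gcongr
    _ ≤ q * |θ - ((p / q : ℚ) : ℝ)| := by gcongr
    _ = _ := habs.symm

/-- If `α` is within `1 / q²` of the reduced fraction `x` of denominator `q`, then every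
half-open interval of length `2 / q` meets the first `q` terms of `i ↦ i * α + c` modulo one. -/
theorem exists_lt_den_mul_add_sub_int_mem_Ico {α : ℝ} {x : ℚ}
    (hx : |α - x| ≤ 1 / (x.den : ℝ) ^ 2) (c u : ℝ) :
    ∃ i < x.den, ∃ k : ℤ, i * α + c - k ∈ Set.Ico u (u + 2 / x.den) := by
  have hden : (0 : ℝ) < x.den := by exact_mod_cast x.pos
  have hsolve (m : ℤ) : ∃ i < x.den, ∃ k : ℤ, (i : ℤ) * x.num = m + x.den * k := by
    obtain ⟨y, z, hyz⟩ := Rat.isCoprime_num_den x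
    have hd : (0 : ℤ) < x.den := by exact_mod_cast x.pos
    have h0 := Int.emod_nonneg (m * y) hd.ne'
    have h1 := Int.emod_lt_of_pos (m * y) hd
    have h2 := Int.emod_add_mul_ediv (m * y) x.den
    refine ⟨(m * y % x.den).toNat, by omega, -(m * z) - m * y / x.den * x.num, ?_⟩
    rw [Int.toNat_of_nonneg h0]
    linear_combination x.num * h2 + m * hyz
  have hnum : (x : ℝ) = x.num / x.den := by exact_mod_cast (Rat.num_div_den x).symm
  have herr (i : ℕ) (hi : i < x.den) : |i * (α - x)| < 1 / x.den := by
    have hi' : (i : ℝ) < x.den := by exact_mod_cast hi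
    rw [abs_mul, Nat.abs_cast]
    calc (i : ℝ) * |α - x| ≤ i * (1 / (x.den : ℝ) ^ 2) := by gcongr
      _ < x.den * (1 / (x.den : ℝ) ^ 2) := by gcongr
      _ = 1 / x.den := by field_simp
  have hpt (m : ℤ) : ∃ i < x.den, ∃ k : ℤ, i * α + c - k = m / x.den + c + i * (α - x) := by
    obtain ⟨i, hi, k, hk⟩ := hsolve m
    refine ⟨i, hi, k, ?_⟩
    have hk' : (i : ℝ) * x.num = m + x.den * k := by exact_mod_cast hk
    have : (i : ℝ) * x = m / x.den + k := by
      rw [hnum]; field_simp; linarith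
    linarith
  set m : ℤ := ⌈(u - c) * x.den⌉ with hm
  have hm0 : u ≤ m / x.den + c := by
    have := (le_div_iff₀ hden).2 (Int.le_ceil ((u - c) * x.den))
    linarith
  have hm1 : m / x.den + c < u + 1 / x.den := by
    have := (div_lt_iff₀ hden).2 (show (m : ℝ) < ((u - c) + 1 / x.den) * x.den by
      rw [add_mul, one_div_mul_cancel hden.ne']
      exact Int.ceil_lt_add_one _)
    linarith
  have h2 : (2 : ℝ) / x.den = 1 / x.den + 1 / x.den := by ring
  rcases le_total 0 (α - x) with hs | hs
  · obtain ⟨i, hi, k, hk⟩ := hpt m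
    have h := (abs_lt.1 (herr i hi)).2
    have h0 : 0 ≤ (i : ℝ) * (α - x) := by positivity
    exact ⟨i, hi, k, by rw [hk]; linarith, by rw [hk]; linarith⟩
  · obtain ⟨i, hi, k, hk⟩ := hpt (m + 1)
    have h := (abs_lt.1 (herr i hi)).1
    have h0 : (i : ℝ) * (α - x) ≤ 0 := mul_nonpos_of_nonneg_of_nonpos (by positivity) hs
    have h3 : ((m + 1 : ℤ) : ℝ) / x.den = m / x.den + 1 / x.den := by push_cast; ring
    exact ⟨i, hi, k, by rw [hk]; linarith, by rw [hk]; linarith⟩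

theorem floor_add_sub_floor_sub_int (x θ : ℝ) (k : ℤ) :
    ⌊x - k + θ⌋ - ⌊x - k⌋ = ⌊x + θ⌋ - ⌊x⌋ := by
  rw [show x - k + θ = x + θ - k by ring, Int.floor_sub_intCast, Int.floor_sub_intCast]
  ring

/-- The coding of a rotation by the interval `[1 - θ, 1)` separates the points `x` and `x + δ`
for all `x` in some interval. -/
theorem exists_forall_Ico_floor_ne {θ δ l : ℝ} (hθ : l ≤ θ) (hθ' : θ ≤ 1 - l)
    (hδ : l ≤ δ) (hδ' : δ ≤ 1 - l) :
    ∃ u, ∀ x ∈ Set.Ico u (u + l), ⌊x + θ⌋ - ⌊x⌋ ≠ ⌊x + δ + θ⌋ - ⌊x + δ⌋ := by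
  rcases le_or_gt (1 - θ) δ with h | h
  · refine ⟨0, fun x ⟨h0, h1⟩ => ?_⟩
    rw [(Int.floor_eq_iff (z := 0)).2, (Int.floor_eq_iff (z := 0)).2,
      (Int.floor_eq_iff (z := 1)).2, (Int.floor_eq_iff (z := 0)).2]
    · norm_num
    all_goals push_cast; constructor <;> linarith
  · refine ⟨1 - l, fun x ⟨h0, h1⟩ => ?_⟩
    rw [(Int.floor_eq_iff (z := 1)).2, (Int.floor_eq_iff (z := 0)).2,
      (Int.floor_eq_iff (z := 1)).2, (Int.floor_eq_iff (z := 1)).2]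
    · norm_num
    all_goals push_cast; constructor <;> linarith

/-- **Theorem 7 (diversity of Sturmian characteristic sequences).**  If `θ ∈ (0,1)` is
irrational with partial quotients bounded by `B`, and `s` is the characteristic Sturmian
sequence of slope `θ`, then for all `0 ≤ a < b < r` there is an index `i ≤ 2(B+2)²r²` with
`s_{ri+a} ≠ s_{ri+b}`; i.e., `r ↦ 2(B+2)²r²` is a diversity measure for `s`. -/
theorem sturmian_diversity (θ : ℝ) (hθ : Irrational θ) (hθ0 : 0 < θ) (hθ1 : θ < 1)
    (B : ℕ) (hB : PartQuotBounded θ B) (r a b : ℕ) (hab : a < b) (hbr : b < r) :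
    ∃ i : ℕ, i ≤ 2 * (B + 2) ^ 2 * r ^ 2 ∧
      sturmian θ (r * i + a) ≠ sturmian θ (r * i + b) := by
  have hr : 0 < r := by omega
  have hr' : (0 : ℝ) < r := by exact_mod_cast hr
  set M : ℝ := (B + 2) * r with hM
  have hM0 : 0 < M := by positivity
  -- Both `θ` and `(b - a) θ` stay at distance at least `1 / M` from the integers.
  have hdist (d : ℕ) (hd : 0 < d) (hdr : d ≤ r) (p : ℤ) : 1 / M ≤ |d * θ - p| := by
    refine le_trans ?_ (hB.one_div_le_abs_mul_sub_int hθ hd p)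
    have hd' : (0 : ℝ) < d := by exact_mod_cast hd
    have : (d : ℝ) ≤ r := by exact_mod_cast hdr
    rw [hM]
    gcongr
  have hl (d : ℕ) (hd : 0 < d) (hdr : d ≤ r) : 1 / M ≤ Int.fract (d * θ) := by
    have := hdist d hd hdr ⌊d * θ⌋
    rwa [Int.self_sub_floor, abs_of_nonneg (Int.fract_nonneg _)] at this
  have hu (d : ℕ) (hd : 0 < d) (hdr : d ≤ r) : Int.fract (d * θ) ≤ 1 - 1 / M := by
    have := hdist d hd hdr (⌊d * θ⌋ + 1)
    have h1 := Int.fract_lt_one (d * θ)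
    rw [show (d * θ - ((⌊d * θ⌋ + 1 : ℤ) : ℝ)) = Int.fract (d * θ) - 1 by
      rw [← Int.self_sub_floor]; push_cast; ring, abs_of_nonpos (by linarith)] at this
    linarith
  have hfθ : Int.fract (((1 : ℕ) : ℝ) * θ) = θ := by
    rw [Nat.cast_one, one_mul, Int.fract_eq_self]
    exact ⟨hθ0.le, hθ1⟩
  have hθl := hl 1 one_pos hr
  have hθu := hu 1 one_pos hr
  rw [hfθ] at hθl hθu
  obtain ⟨u, hu'⟩ := exists_forall_Ico_floor_ne hθl hθu
    (hl (b - a) (by omega) (by omega)) (hu (b - a) (by omega) (by omega))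
  set n := 2 * (B + 2) ^ 2 * r ^ 2 with hn
  have hnM : (n : ℝ) = 2 * M ^ 2 := by rw [hn, hM]; push_cast; ring
  obtain ⟨x, hx, hxn⟩ := Real.exists_rat_abs_sub_le_and_den_le (r * θ) (n := n) (by positivity)
  have hden : (0 : ℝ) < x.den := by exact_mod_cast x.pos
  have hxn' : (x.den : ℝ) ≤ n := by exact_mod_cast hxn
  have hbig : 2 * M ≤ x.den := by
    have h1 := hB.one_div_le_abs_mul_sub_int hθ (Nat.mul_pos x.pos hr) x.num
    have h2 : |((x.den * r : ℕ) : ℝ) * θ - x.num| ≤ 1 / (n + 1) := by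
      have hnum : (x : ℝ) = x.num / x.den := by exact_mod_cast (Rat.num_div_den x).symm
      calc |((x.den * r : ℕ) : ℝ) * θ - x.num| = |x.den * (r * θ - x)| := by
            congr 1; rw [hnum]; push_cast; field_simp
        _ = x.den * |r * θ - x| := by rw [abs_mul, Nat.abs_cast]
        _ ≤ x.den * (1 / ((n + 1) * x.den)) := by gcongr
        _ = 1 / (n + 1) := by field_simp
    have h3 := h1.trans h2
    push_cast at h3
    rw [div_le_div_iff₀ (by positivity) (by positivity), hnM] at h3
    have h4 : 2 * M * M ≤ x.den * M := by rw [hM] at h3 ⊢; nlinarith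
    exact le_of_mul_le_mul_right h4 hM0
  have hx' : |(r : ℝ) * θ - x| ≤ 1 / (x.den : ℝ) ^ 2 := by
    refine hx.trans ?_
    gcongr
    nlinarith
  obtain ⟨i, hi, k, hk0, hk1⟩ :=
    exists_lt_den_mul_add_sub_int_mem_Ico hx' (((a : ℝ) + 1) * θ) u
  refine ⟨i, by omega, ?_⟩
  have hlen : (2 : ℝ) / x.den ≤ 1 / M := by
    rw [div_le_div_iff₀ hden hM0]; linarith
  have hne := hu' _ ⟨hk0, hk1.trans_le (by linarith)⟩
  have hδ : Int.fract (((b - a : ℕ) : ℝ) * θ) = (b - a) * θ - ⌊((b - a : ℕ) : ℝ) * θ⌋ := by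
    rw [← Int.self_sub_floor, Nat.cast_sub hab.le]
  set j := ⌊((b - a : ℕ) : ℝ) * θ⌋
  rw [floor_add_sub_floor_sub_int, hδ,
    show (i : ℝ) * (r * θ) + (a + 1) * θ - k + ((b - a) * θ - j) =
      (i * (r * θ) + (b + 1) * θ) - ((k + j : ℤ) : ℝ) by push_cast; ring,
    floor_add_sub_floor_sub_int] at hne
  unfold sturmian
  push_cast
  convert hne using 3 <;> ring_nf
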